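/- Let φ be a flow on a generalized Peano continuum M and let Λ be a compact minimal set. If every neighborhood of Λ in M contains an attractor, then either Λ is itself an attractor, or every neighborhood of Λ in M contains a Lyapunov unstable compact minimal set. -/

import Mathlib

open Set Filter Topology Metric TopologicalSpace

variable {M : Type*} [MetricSpace M]

/-- A set is invariant under the flow `φ`. -/
def IsFlowInvariant (φ : ℝ → M → M) (K : Set M) : Prop :=
  ∀ x ∈ K, ∀ t : ℝ, φ t x ∈ K

/-- A set is positively invariant under the flow `φ`. -/
def IsPosInvariant (φ : ℝ → M → M) (K : Set M) : Prop :=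
  ∀ x ∈ K, ∀ t : ℝ, 0 ≤ t → φ t x ∈ K

/-- A compact minimal set: nonempty, compact, invariant, with no nonempty proper
closed invariant subset. -/
def IsCompactMinimalSet (φ : ℝ → M → M) (K : Set M) : Prop :=
  K.Nonempty ∧ IsCompact K ∧ IsFlowInvariant φ K ∧
    ∀ K' ⊆ K, K'.Nonempty → IsClosed K' → IsFlowInvariant φ K' → K' = K

/-- Lyapunov stability: every neighborhood of `K` contains a positively invariant
neighborhood of `K`. -/
def IsLyapunovStable (φ : ℝ → M → M) (K : Set M) : Prop :=
  ∀ U ∈ 𝓝ˢ K, ∃ V ∈ 𝓝ˢ K, V ⊆ U ∧ IsPosInvariant φ V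

/-- The ω-limit set of a point. -/
def omegaLimitSet (φ : ℝ → M → M) (x : M) : Set M :=
  ⋂ T ∈ Ici (0 : ℝ), closure ((fun t => φ t x) '' Ici T)

/-- The α-limit set of a point. -/
def alphaLimitSet (φ : ℝ → M → M) (x : M) : Set M :=
  ⋂ T ∈ Iic (0 : ℝ), closure ((fun t => φ t x) '' Iic T)

/-- A compact minimal set is hyper-stable if some neighborhood of it in `M` meets no
Lyapunov unstable compact minimal set. -/
def IsHyperStable (φ : ℝ → M → M) (Λ : Set M) : Prop :=
  IsCompactMinimalSet φ Λ ∧ ∃ W ∈ 𝓝ˢ Λ, ∀ Γ : Set M,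
    IsCompactMinimalSet φ Γ → ¬ IsLyapunovStable φ Γ → Γ ∩ W = ∅

/-- An attractor: a Lyapunov stable nonempty compact invariant set whose basin of
attraction is a neighborhood of it. -/
def IsAttractorSet (φ : ℝ → M → M) (Δ : Set M) : Prop :=
  Δ.Nonempty ∧ IsCompact Δ ∧ IsFlowInvariant φ Δ ∧ IsLyapunovStable φ Δ ∧
    {x : M | (omegaLimitSet φ x).Nonempty ∧ omegaLimitSet φ x ⊆ Δ} ∈ 𝓝ˢ Δ

/-- The flow is non-wandering. -/
def IsNonWanderingFlow (φ : ℝ → M → M) : Prop :=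
  ∀ x : M, ∀ U ∈ 𝓝 x, ∀ T > (0 : ℝ), ∃ t ≥ T, ((fun y => φ t y) '' U ∩ U).Nonempty

/-- The set of hyper-stable compact minimal sets, as a subset of the space of nonempty
compact subsets of `M` (with the Hausdorff metric). -/
def HSset (φ : ℝ → M → M) : Set (NonemptyCompacts M) :=
  {Γ | IsHyperStable φ (Γ : Set M)}

/-- The set of all compact minimal sets, as a subset of the space of nonempty compact
subsets of `M` (with the Hausdorff metric). -/
def CMinSet (φ : ℝ → M → M) : Set (NonemptyCompacts M) :=
  {Γ | IsCompactMinimalSet φ (Γ : Set M)}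

/-- `basinOf φ X` is the set of points whose ω-limit set belongs to `X`. -/
def basinOf (φ : ℝ → M → M) (X : Set (NonemptyCompacts M)) : Set M :=
  {x | ∃ Γ ∈ X, (Γ : Set M) = omegaLimitSet φ x}

/-- The union in `M` of a family of hyper-stable compact minimal sets. -/
def unionSet (φ : ℝ → M → M) (X : Set ↥(HSset φ)) : Set M :=
  {y | ∃ q ∈ X, y ∈ ((q : NonemptyCompacts M) : Set M)}

theorem mem_omegaLimitSet_iff {φ : ℝ → M → M} {x y : M} :
    y ∈ omegaLimitSet φ x ↔ MapClusterPt y atTop fun t => φ t x := by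
  have hb : (atTop : Filter ℝ).HasBasis (fun T => 0 ≤ T) Ici := by
    refine atTop_basis.to_hasBasis (fun T _ => ⟨max T 0, le_max_right _ _, ?_⟩)
      fun T _ => ⟨T, trivial, subset_rfl⟩
    exact Ici_subset_Ici.2 (le_max_left _ _)
  rw [mapClusterPt_def, (hb.map _).clusterPt_iff_forall_mem_closure]
  simp [omegaLimitSet]

theorem isClosed_omegaLimitSet {φ : ℝ → M → M} {x : M} : IsClosed (omegaLimitSet φ x) :=
  isClosed_biInter fun _ _ => isClosed_closure

theorem omegaLimitSet_subset_of_eventually {φ : ℝ → M → M} {x : M} {C : Set M}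
    (hC : IsClosed C) (h : ∀ᶠ t in atTop, φ t x ∈ C) : omegaLimitSet φ x ⊆ C := fun _ hy =>
  isClosed_iff_clusterPt.1 hC _ ((mem_omegaLimitSet_iff.1 hy).clusterPt.mono (le_principal_iff.2 h))

theorem omegaLimitSet_nonempty {φ : ℝ → M → M} {x : M} {K : Set M} (hK : IsCompact K)
    (h : ∀ᶠ t in atTop, φ t x ∈ K) : (omegaLimitSet φ x).Nonempty := by
  obtain ⟨y, -, hy⟩ := hK.exists_mapClusterPt (le_principal_iff.2 h)
  exact ⟨y, mem_omegaLimitSet_iff.2 hy⟩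

theorem omegaLimitSet_apply {φ : ℝ → M → M}
    (hφadd : ∀ s t : ℝ, ∀ x : M, φ s (φ t x) = φ (s + t) x) (t : ℝ) (x : M) :
    omegaLimitSet φ (φ t x) = omegaLimitSet φ x := by
  ext y
  simp only [mem_omegaLimitSet_iff, hφadd, MapClusterPt]
  conv_rhs => rw [← (OrderIso.addRight t).map_atTop, map_map]
  rfl

theorem isFlowInvariant_omegaLimitSet {φ : ℝ → M → M}
    (hφcont : Continuous fun p : ℝ × M => φ p.1 p.2)
    (hφadd : ∀ s t : ℝ, ∀ x : M, φ s (φ t x) = φ (s + t) x) (x : M) :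
    IsFlowInvariant φ (omegaLimitSet φ x) := by
  intro y hy t
  have hct : Continuous (φ t) := hφcont.comp (Continuous.prodMk_right t)
  rw [← omegaLimitSet_apply hφadd t, mem_omegaLimitSet_iff]
  have h := (mem_omegaLimitSet_iff.1 hy).continuousAt_comp hct.continuousAt
  refine h.congrFun (Eventually.of_forall fun s => ?_)
  simp [hφadd, add_comm]

/-- Every nonempty compact invariant set contains a compact minimal set. -/
theorem exists_isCompactMinimalSet_subset {φ : ℝ → M → M} {K : Set M} (hne : K.Nonempty)
    (hK : IsCompact K) (hinv : IsFlowInvariant φ K) :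
    ∃ Γ ⊆ K, IsCompactMinimalSet φ Γ := by
  obtain ⟨Γ, hΓK, ⟨hΓne, hΓcl, hΓinv, -⟩, hmin⟩ := zorn_superset_nonempty
    {S : Set M | S.Nonempty ∧ IsClosed S ∧ IsFlowInvariant φ S ∧ S ⊆ K} (by
      intro c hc hchain hcne
      refine ⟨⋂₀ c, ⟨?_, isClosed_sInter fun s hs => (hc hs).2.1,
        fun x hx t s hs => (hc hs).2.2.1 x (hx s hs) t, ?_⟩, fun s hs => sInter_subset_of_mem hs⟩
      · have := hcne.to_subtype
        rw [sInter_eq_iInter]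
        refine IsCompact.nonempty_iInter_of_directed_nonempty_isCompact_isClosed _ ?_
          (fun s => (hc s.2).1) (fun s => hK.of_isClosed_subset (hc s.2).2.1 (hc s.2).2.2.2)
          fun s => (hc s.2).2.1
        rintro ⟨s, hs⟩ ⟨t, ht⟩
        rcases hchain.total hs ht with h | h
        · exact ⟨⟨s, hs⟩, subset_rfl, h⟩
        · exact ⟨⟨t, ht⟩, h, subset_rfl⟩
      · obtain ⟨s, hs⟩ := hcne
        exact (sInter_subset_of_mem hs).trans (hc hs).2.2.2)
    K ⟨hne, hK.isClosed, hinv, subset_rfl⟩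
  refine ⟨Γ, hΓK, hΓne, hK.of_isClosed_subset hΓcl hΓK, hΓinv, fun S hS hSne hScl hSinv => ?_⟩
  exact hS.antisymm (hmin ⟨hSne, hScl, hSinv, hS.trans hΓK⟩ hS)

theorem IsCompactMinimalSet.isPreconnected {φ : ℝ → M → M} {Λ : Set M}
    (hφcont : Continuous fun p : ℝ × M => φ p.1 p.2)
    (hφzero : ∀ x : M, φ 0 x = x)
    (hφadd : ∀ s t : ℝ, ∀ x : M, φ s (φ t x) = φ (s + t) x)
    (hΛ : IsCompactMinimalSet φ Λ) : IsPreconnected Λ := by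
  obtain ⟨⟨x, hx⟩, hcpt, hinv, hmin⟩ := hΛ
  have horb : range (fun t => φ t x) ⊆ Λ := range_subset_iff.2 (hinv x hx)
  have hcl : closure (range fun t => φ t x) = Λ := by
    refine hmin _ (closure_minimal horb hcpt.isClosed)
      ⟨x, subset_closure ⟨0, hφzero x⟩⟩ isClosed_closure fun y hy t => ?_
    refine map_mem_closure (hφcont.comp (Continuous.prodMk_right t)) hy ?_
    rintro _ ⟨s, rfl⟩
    exact ⟨t + s, (hφadd t s x).symm⟩
  rw [← hcl]
  exact (isPreconnected_range (hφcont.comp (Continuous.prodMk_left x))).closure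

/-- The basin of `Δ`: the points whose ω-limit set is nonempty and contained in `Δ`. -/
def attractionBasin (φ : ℝ → M → M) (Δ : Set M) : Set M :=
  {x : M | (omegaLimitSet φ x).Nonempty ∧ omegaLimitSet φ x ⊆ Δ}

theorem apply_mem_attractionBasin_iff {φ : ℝ → M → M}
    (hφadd : ∀ s t : ℝ, ∀ x : M, φ s (φ t x) = φ (s + t) x) {Δ : Set M} {t : ℝ} {x : M} :
    φ t x ∈ attractionBasin φ Δ ↔ x ∈ attractionBasin φ Δ := by
  simp only [attractionBasin, mem_ofPred_eq, omegaLimitSet_apply hφadd]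

theorem exists_apply_mem_interior {φ : ℝ → M → M} {x : M} {S V : Set M} (hV : V ∈ 𝓝ˢ S)
    (h : (omegaLimitSet φ x ∩ S).Nonempty) : ∃ t : ℝ, φ t x ∈ interior V := by
  obtain ⟨y, hy, hyS⟩ := h
  exact ((mem_omegaLimitSet_iff.1 hy).frequently
    (isOpen_interior.mem_nhds (subset_interior_iff_mem_nhdsSet.2 hV hyS))).exists

theorem IsAttractorSet.mem_attractionBasin_of_inter_nonempty {φ : ℝ → M → M}
    (hφadd : ∀ s t : ℝ, ∀ x : M, φ s (φ t x) = φ (s + t) x) {Δ : Set M}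
    (hΔ : IsAttractorSet φ Δ) {x : M} (h : (omegaLimitSet φ x ∩ Δ).Nonempty) :
    x ∈ attractionBasin φ Δ := by
  obtain ⟨t, ht⟩ := exists_apply_mem_interior hΔ.2.2.2.2 h
  exact (apply_mem_attractionBasin_iff hφadd).1 (interior_subset ht)

theorem IsAttractorSet.isOpen_attractionBasin {φ : ℝ → M → M}
    (hφcont : Continuous fun p : ℝ × M => φ p.1 p.2)
    (hφadd : ∀ s t : ℝ, ∀ x : M, φ s (φ t x) = φ (s + t) x) {Δ : Set M}
    (hΔ : IsAttractorSet φ Δ) : IsOpen (attractionBasin φ Δ) := by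
  refine isOpen_iff_mem_nhds.2 fun x hx => ?_
  obtain ⟨t, ht⟩ := exists_apply_mem_interior hΔ.2.2.2.2
    (by rw [inter_eq_left.2 hx.2]; exact hx.1)
  have hct : Continuous (φ t) := hφcont.comp (Continuous.prodMk_right t)
  filter_upwards [hct.continuousAt.preimage_mem_nhds (isOpen_interior.mem_nhds ht)] with z hz
  exact (apply_mem_attractionBasin_iff hφadd).1 (interior_subset hz)

/-- A point whose ω-limit set contains a stable set disjoint from `Δ` is not in the closure of
the basin of `Δ`. -/
theorem notMem_closure_attractionBasin {φ : ℝ → M → M}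
    (hφcont : Continuous fun p : ℝ × M => φ p.1 p.2)
    (hφadd : ∀ s t : ℝ, ∀ x : M, φ s (φ t x) = φ (s + t) x) {Δ Γ : Set M} {y : M}
    (hΔ : IsClosed Δ) (hΓne : Γ.Nonempty) (hΓ : IsClosed Γ) (hst : IsLyapunovStable φ Γ)
    (hΓy : Γ ⊆ omegaLimitSet φ y) (hdisj : Disjoint Γ Δ) :
    y ∉ closure (attractionBasin φ Δ) := by
  obtain ⟨O, O', hO, hO', hΓO, hΔO', hOO'⟩ := normal_separation hΓ hΔ hdisj
  obtain ⟨V, hV, hVO, hVpos⟩ := hst O (hO.mem_nhdsSet.2 hΓO)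
  obtain ⟨t, ht⟩ := exists_apply_mem_interior hV (by rwa [inter_eq_right.2 hΓy])
  have hct : Continuous (φ t) := hφcont.comp (Continuous.prodMk_right t)
  have hnear : ∀ᶠ z in 𝓝 y, z ∉ attractionBasin φ Δ := by
    filter_upwards [hct.continuousAt.preimage_mem_nhds (isOpen_interior.mem_nhds ht)] with z hz hzB
    obtain ⟨⟨w, hw⟩, hsub⟩ := (apply_mem_attractionBasin_iff hφadd (t := t)).2 hzB
    have : omegaLimitSet φ (φ t z) ⊆ O'ᶜ := by
      refine omegaLimitSet_subset_of_eventually hO'.isClosed_compl ?_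
      filter_upwards [eventually_ge_atTop 0] with s hs
      exact hOO'.subset_compl_right (hVO (hVpos _ (interior_subset hz) s hs))
    exact this hw (hΔO' (hsub hw))
  rw [mem_closure_iff_frequently]
  exact fun hfreq => hfreq hnear

theorem attractor_or_unstable_nearby [LocallyCompactSpace M] [ConnectedSpace M] [LocallyConnectedSpace M]
    (φ : ℝ → M → M)
    (hφcont : Continuous fun p : ℝ × M => φ p.1 p.2)
    (hφzero : ∀ x : M, φ 0 x = x)
    (hφadd : ∀ s t : ℝ, ∀ x : M, φ s (φ t x) = φ (s + t) x)
    (Λ : Set M) (hΛ : IsCompactMinimalSet φ Λ)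
    (hattr : ∀ W ∈ 𝓝ˢ Λ, ∃ Δ : Set M, Δ ⊆ W ∧ IsAttractorSet φ Δ) :
    IsAttractorSet φ Λ ∨
      ∀ W ∈ 𝓝ˢ Λ, ∃ Γ : Set M, Γ ⊆ W ∧ IsCompactMinimalSet φ Γ ∧ ¬ IsLyapunovStable φ Γ := by
  by_contra! hcon
  obtain ⟨hnattr, W, hW, hst⟩ := hcon
  obtain ⟨K, hK, hΛK, hKW⟩ := exists_compact_between hΛ.2.1 isOpen_interior
    (subset_interior_iff_mem_nhdsSet.2 hW)
  have hΛst : IsLyapunovStable φ Λ := hst Λ (subset_of_mem_nhdsSet hW) hΛ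
  obtain ⟨N, hN, hNK, hNpos⟩ := hΛst K (subset_interior_iff_mem_nhdsSet.1 hΛK)
  have hΛN : Λ ⊆ interior N := subset_interior_iff_mem_nhdsSet.2 hN
  have ⟨x₀, hx₀⟩ := hΛ.1
  set U := connectedComponentIn (interior N) x₀
  have hUopen : IsOpen U := isOpen_interior.connectedComponentIn
  have hΛU : Λ ⊆ U :=
    (hΛ.isPreconnected hφcont hφzero hφadd).subset_connectedComponentIn hx₀ hΛN
  have hUnhds : U ∈ 𝓝ˢ Λ := hUopen.mem_nhdsSet.2 hΛU
  have hev : ∀ y ∈ U, ∀ᶠ t in atTop, φ t y ∈ K := fun y hy => by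
    filter_upwards [eventually_ge_atTop 0] with t ht
    exact hNK (hNpos y (interior_subset (connectedComponentIn_subset _ _ hy)) t ht)
  have hbasin : ∀ Δ ⊆ U, IsAttractorSet φ Δ → U ⊆ attractionBasin φ Δ := by
    intro Δ hΔU hΔ
    refine isPreconnected_connectedComponentIn.subset_of_closure_inter_subset
      (hΔ.isOpen_attractionBasin hφcont hφadd) ?_ ?_
    · obtain ⟨x, hx⟩ := hΔ.1
      exact ⟨x, hΔU hx, subset_of_mem_nhdsSet hΔ.2.2.2.2 hx⟩
    · rintro y ⟨hycl, hyU⟩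
      by_contra hyB
      have hωK := omegaLimitSet_subset_of_eventually hK.isClosed (hev y hyU)
      obtain ⟨Γ, hΓω, hΓ⟩ := exists_isCompactMinimalSet_subset
        (omegaLimitSet_nonempty hK (hev y hyU))
        (hK.of_isClosed_subset isClosed_omegaLimitSet hωK)
        (isFlowInvariant_omegaLimitSet hφcont hφadd y)
      have hdisj : Disjoint (omegaLimitSet φ y) Δ := by
        rw [disjoint_iff_inter_eq_empty, ← not_nonempty_iff_eq_empty]
        exact fun h => hyB (hΔ.mem_attractionBasin_of_inter_nonempty hφadd h)
      exact notMem_closure_attractionBasin hφcont hφadd hΔ.2.1.isClosed hΓ.1 hΓ.2.1.isClosed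
        (hst Γ (hΓω.trans (hωK.trans (hKW.trans interior_subset))) hΓ) hΓω
        (hdisj.mono_left hΓω) hycl
  refine hnattr ⟨hΛ.1, hΛ.2.1, hΛ.2.2.1, hΛst, mem_of_superset hUnhds fun x hx =>
    ⟨omegaLimitSet_nonempty hK (hev x hx), fun y hy => ?_⟩⟩
  by_contra hyΛ
  obtain ⟨Δ, hΔsub, hΔ⟩ := hattr (U ∩ {y}ᶜ) (inter_mem hUnhds
    (isOpen_compl_singleton.mem_nhdsSet.2 (subset_compl_singleton_iff.2 hyΛ)))
  exact (hΔsub ((hbasin Δ (hΔsub.trans inter_subset_left) hΔ hx).2 hy)).2 rfl
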